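/- arXiv:0908.3593 — 5 statements merged into one kernel-verified Lean document; each statement's English description precedes it below -/
import Mathlib

section
/- Let X₁,…,Xₙ be i.i.d. from a probability measure P on [0,1]^d with density f with respect to Lebesgue measure μ. For any 0 < δ < 1, with probability at least 1 − δ, the following holds simultaneously for all integers j ≥ 0: max_{A ∈ 𝒜_j} |f̄(A) − f̂(A)| ≤ Ψ_j, where Ψ_j is the penalty with confidence parameter δ. -/
open MeasureTheory Filter

noncomputable section

abbrev Pt (d : ℕ) := EuclideanSpace ℝ (Fin d)

/-- The unit cube `[0,1]^d`. -/
def cube (d : ℕ) : Set (Pt d) := {x | ∀ i, 0 ≤ x i ∧ x i ≤ 1}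

/-- The closed `ε`-ball around `x`, relative to the cube `[0,1]^d`. -/
def ballC (d : ℕ) (x : Pt d) (ε : ℝ) : Set (Pt d) := {y ∈ cube d | dist y x ≤ ε}

/-- The inner `ε`-cover of `G`: the union of all `ε`-balls contained in `G`. -/
def innerCover (d : ℕ) (ε : ℝ) (G : Set (Pt d)) : Set (Pt d) :=
  ⋃ x ∈ {x : Pt d | ballC d x ε ⊆ G}, ballC d x ε

open Classical in
/-- The Hausdorff error `d_∞(G₁, G₂)`, defined as `√d` if either set is empty. -/
def hausd (d : ℕ) (G₁ G₂ : Set (Pt d)) : ℝ :=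
  if G₁.Nonempty ∧ G₂.Nonempty then
    max (⨆ x ∈ G₂, Metric.infDist x G₁) (⨆ x ∈ G₁, Metric.infDist x G₂)
  else Real.sqrt d

/-- Indices for the cells of the regular partition of `[0,1]^d` at resolution `j`. -/
abbrev CellIdx (d j : ℕ) := Fin d → Fin (2 ^ j)

/-- The dyadic hypercube cell of sidelength `2⁻ʲ` indexed by `k` (cells on the
upper boundary of the cube are closed on the right, so that the cells partition
`[0,1]^d`). -/
def cell (d j : ℕ) (k : CellIdx d j) : Set (Pt d) :=
  {x | ∀ i, ((k i : ℕ) : ℝ) / 2 ^ j ≤ x i ∧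
    (x i < (((k i : ℕ) : ℝ) + 1) / 2 ^ j ∨ ((k i : ℕ) + 1 = 2 ^ j ∧ x i ≤ 1))}

/-- Empirical probability of a set `A`. -/
def Phat {d n : ℕ} (ω : Fin n → Pt d) (A : Set (Pt d)) : ℝ :=
  (∑ i, A.indicator (fun _ => (1 : ℝ)) (ω i)) / n

/-- Empirical average density `f̂(A) = P̂(A)/μ(A)` of the cell indexed by `k`. -/
def fhat {d n : ℕ} (j : ℕ) (ω : Fin n → Pt d) (k : CellIdx d j) : ℝ :=
  Phat ω (cell d j k) * 2 ^ (j * d)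

/-- True average density `f̄(A) = P(A)/μ(A)` of the cell indexed by `k`. -/
def fbar {d : ℕ} (P : Measure (Pt d)) (j : ℕ) (k : CellIdx d j) : ℝ :=
  (P (cell d j k)).toReal * 2 ^ (j * d)

/-- The plug-in level set estimator at resolution `j`. -/
def Ghat (d n j : ℕ) (γ : ℝ) (ω : Fin n → Pt d) : Set (Pt d) :=
  ⋃ k ∈ {k : CellIdx d j | γ ≤ fhat j ω k}, cell d j k

/-- The `γ`-level set of `f` on `[0,1]^d`. -/
def Gstar (d : ℕ) (f : Pt d → ℝ) (γ : ℝ) : Set (Pt d) := {x ∈ cube d | γ ≤ f x}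

/-- The penalty `Ψ_j` at resolution `j` with confidence parameter `δ`. -/
def pen (d n j : ℕ) (δ : ℝ) (ω : Fin n → Pt d) : ℝ :=
  ⨆ k : CellIdx d j,
    Real.sqrt (8 * (Real.log ((2 : ℝ) ^ (j * (d + 1)) * 16 / δ) / ((n : ℝ) / 2 ^ (j * d))) *
      max (fhat j ω k)
        (8 * (Real.log ((2 : ℝ) ^ (j * (d + 1)) * 16 / δ) / ((n : ℝ) / 2 ^ (j * d)))))

/-- `j' = ⌊j + log₂ s⌋`. -/
def jprime (j : ℕ) (s : ℝ) : ℕ := (⌊(j : ℝ) + Real.logb 2 s⌋).toNat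

/-- Generic vernier: min over cells at resolution `j` of the max over subcells at
resolution `j'` of `|γ - g(A')|`. -/
def vernier (d : ℕ) (γ : ℝ) (j j' : ℕ) (g : CellIdx d j' → ℝ) : ℝ :=
  ⨅ k : CellIdx d j, ⨆ k' : {k' : CellIdx d j' // cell d j' k' ⊆ cell d j k}, |γ - g k'.1|

/-- The vernier `V_{γ,j}`. -/
def V (d : ℕ) (P : Measure (Pt d)) (γ : ℝ) (j j' : ℕ) : ℝ := vernier d γ j j' (fbar P j')

/-- The empirical vernier `V̂_{γ,j}`. -/
def Vhat (d n : ℕ) (ω : Fin n → Pt d) (γ : ℝ) (j j' : ℕ) : ℝ := vernier d γ j j' (fhat j' ω)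

/-- The joint distribution of `n` i.i.d. observations from `P`. -/
def Pn {d : ℕ} (P : Measure (Pt d)) (n : ℕ) : Measure (Fin n → Pt d) :=
  Measure.pi fun _ => P

/-- `f` is a probability density (w.r.t. Lebesgue measure) supported on the unit cube,
and `P` is the corresponding probability measure. -/
def IsDensity (d : ℕ) (f : Pt d → ℝ) (P : Measure (Pt d)) : Prop :=
  Measurable f ∧ (∀ x, 0 ≤ f x) ∧ (∀ x, x ∉ cube d → f x = 0) ∧
  P = volume.withDensity (fun x => ENNReal.ofReal (f x)) ∧ IsProbabilityMeasure P

/-- The density `f` is bounded by `fmax`. -/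
def BoundedBy (d : ℕ) (f : Pt d → ℝ) (fmax : ℝ) : Prop := ∀ x, f x ≤ fmax

/-- Assumption [A1]: local density regularity (lower bound). -/
def A1 (d : ℕ) (f : Pt d → ℝ) (γ C₁ δ₁ α : ℝ) : Prop :=
  ∀ x ∈ cube d, |f x - γ| ≤ δ₁ →
    C₁ * Metric.infDist x (frontier (Gstar d f γ)) ^ α ≤ |f x - γ|

/-- Assumption [A2]: local density regularity (upper bound near some boundary point). -/
def A2 (d : ℕ) (f : Pt d → ℝ) (γ C₂ δ₂ α : ℝ) : Prop :=
  ∃ x₀ ∈ frontier (Gstar d f γ), ∀ x ∈ ballC d x₀ δ₂,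
    |f x - γ| ≤ C₂ * Metric.infDist x (frontier (Gstar d f γ)) ^ α

/-- Assumption [B]: level set regularity. -/
def AB (d : ℕ) (G : Set (Pt d)) (C₃ ε₀ : ℝ) : Prop :=
  ∀ ε : ℝ, 0 < ε → ε ≤ ε₀ →
    (innerCover d ε G).Nonempty ∧
    ∀ x ∈ frontier G, Metric.infDist x (innerCover d ε G) ≤ C₃ * ε

lemma measurableSet_cell (d j : ℕ) (k : CellIdx d j) : MeasurableSet (cell d j k) := by
  rw [cell, Set.ofPred_forall]
  refine MeasurableSet.iInter fun i => ?_
  have h : Measurable fun x : Pt d => x i := by fun_prop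
  exact (measurableSet_le measurable_const h).inter
    ((measurableSet_lt h measurable_const).union
      ((MeasurableSet.const _).inter (measurableSet_le h measurable_const)))

/-- The moment generating function of a centred Bernoulli variable is at most `exp (p x²)`. -/
lemma integrable_and_integral_exp_indicator_le {d : ℕ} (P : Measure (Pt d))
    [IsProbabilityMeasure P] {A : Set (Pt d)} (hA : MeasurableSet A) {x : ℝ} (hx : |x| ≤ 1) :
    Integrable (fun y => Real.exp (x * (A.indicator (fun _ => (1 : ℝ)) y - P.real A))) P ∧
    ∫ y, Real.exp (x * (A.indicator (fun _ => (1 : ℝ)) y - P.real A)) ∂P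
      ≤ Real.exp (P.real A * x ^ 2) := by
  set p := P.real A
  have hp : 0 ≤ p := measureReal_nonneg
  have hfun : (fun y => Real.exp (x * (A.indicator (fun _ => (1 : ℝ)) y - p))) =
      fun y => Real.exp (-(x * p)) * (1 + A.indicator (fun _ => Real.exp x - 1) y) := by
    funext y
    by_cases hy : y ∈ A
    · simp only [Set.indicator_of_mem hy, add_sub_cancel, ← Real.exp_add]
      ring_nf
    · simp [Set.indicator_of_notMem hy]
  have hind : Integrable (A.indicator fun _ => Real.exp x - 1) P :=
    (integrable_const _).indicator hA
  rw [hfun]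
  refine ⟨((integrable_const _).add hind).const_mul _, ?_⟩
  rw [integral_const_mul, integral_add (integrable_const _) hind, integral_indicator_const _ hA]
  have h1 : Real.exp x - 1 ≤ x + x ^ 2 := by
    linarith [(abs_le.mp (Real.abs_exp_sub_one_sub_id_le hx)).2]
  calc Real.exp (-(x * p)) * (∫ _, (1 : ℝ) ∂P + p • (Real.exp x - 1))
      ≤ Real.exp (-(x * p)) * Real.exp (p * (x + x ^ 2)) := by
        gcongr
        have := Real.add_one_le_exp (p * (x + x ^ 2))
        have := mul_le_mul_of_nonneg_left h1 hp
        simp only [integral_const, probReal_univ, smul_eq_mul, mul_one]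
        linarith
    _ = Real.exp (p * x ^ 2) := by rw [← Real.exp_add]; ring_nf

/-- Chernoff bound for the empirical probability of a set. -/
lemma measureReal_chernoff_le {d n : ℕ} (hn : 1 ≤ n) (P : Measure (Pt d))
    [IsProbabilityMeasure P] {A : Set (Pt d)} (hA : MeasurableSet A) {x : ℝ} (hx : |x| ≤ 1)
    (t : ℝ) :
    (Pn P n).real {ω | P.real A * x ^ 2 + t ≤ x * (Phat ω A - P.real A)} ≤
      Real.exp (-(n * t)) := by
  obtain ⟨hint, hle⟩ := integrable_and_integral_exp_indicator_le P hA hx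
  set p := P.real A
  set g : Pt d → ℝ := fun y => Real.exp (x * (A.indicator (fun _ => (1 : ℝ)) y - p))
  have hn0 : (n : ℝ) ≠ 0 := by positivity
  have hprod : ∀ ω : Fin n → Pt d, ∏ i, g (ω i) = Real.exp (n * (x * (Phat ω A - p))) := by
    intro ω
    rw [← Real.exp_sum, ← Finset.mul_sum, Finset.sum_sub_distrib, Phat]
    congr 1
    simp only [Finset.sum_const, Finset.card_univ, Fintype.card_fin, nsmul_eq_mul]
    field_simp
  have hmarkov := mul_meas_ge_le_integral_of_nonneg (μ := Pn P n)
    (f := fun ω => ∏ i, g (ω i))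
    (ae_of_all _ fun ω => Finset.prod_nonneg fun i _ => (Real.exp_pos _).le)
    (Integrable.fintype_prod fun _ => hint) (Real.exp (n * (p * x ^ 2 + t)))
  have hpow : ∫ ω, ∏ i, g (ω i) ∂(Pn P n) ≤ Real.exp (n * (p * x ^ 2)) := by
    rw [Pn, integral_fintype_prod_eq_prod (fun _ => g), Finset.prod_const, Finset.card_univ,
      Fintype.card_fin, Real.exp_nat_mul]
    exact pow_le_pow_left₀ (integral_nonneg fun _ => (Real.exp_pos _).le) hle n
  have hset : {ω : Fin n → Pt d | p * x ^ 2 + t ≤ x * (Phat ω A - p)} =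
      {ω | Real.exp (n * (p * x ^ 2 + t)) ≤ ∏ i, g (ω i)} := by
    ext ω
    simp only [Set.mem_ofPred_eq, hprod, Real.exp_le_exp]
    rw [mul_le_mul_iff_right₀ (by positivity)]
  rw [hset]
  have h := hmarkov.trans hpow
  rw [mul_comm, ← le_div_iff₀ (Real.exp_pos _), ← Real.exp_sub] at h
  exact h.trans_eq (by ring_nf)

/-- If `u` is a large deviation at level `t` for a Bernoulli variable of mean `p`, then the
choice `min 1 √(t/p)` of the Chernoff parameter detects it. -/
lemma exists_chernoff_parameter {p t : ℝ} (ht : 0 < t) :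
    ∃ x : ℝ, 0 ≤ x ∧ x ≤ 1 ∧ ∀ u, 8 * t ≤ u → 4 * t * p ≤ u ^ 2 → p * x ^ 2 + t ≤ x * u := by
  rcases le_total t p with h | h
  · have hp' : 0 < p := ht.trans_le h
    refine ⟨√(t / p), Real.sqrt_nonneg _, Real.sqrt_le_one.mpr ((div_le_one hp').mpr h), ?_⟩
    intro u hu hup
    rw [Real.sq_sqrt (by positivity), mul_div_cancel₀ _ hp'.ne']
    rw [← Real.sqrt_sq (show 0 ≤ u by linarith), ← Real.sqrt_mul (by positivity)]
    refine Real.le_sqrt_of_sq_le ?_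
    rw [div_mul_eq_mul_div, le_div_iff₀ hp']
    nlinarith
  · exact ⟨1, zero_le_one, le_rfl, fun u hu _ => by linarith⟩

/-- A deviation beyond the plug-in penalty exceeds the Bernstein-type deviation. -/
lemma le_abs_sub_of_sqrt_lt {p q t : ℝ} (ht : 0 < t)
    (h : √(8 * t * max q (8 * t)) < |p - q|) :
    8 * t ≤ |p - q| ∧ 4 * t * p ≤ |p - q| ^ 2 := by
  have hu : 0 ≤ |p - q| := abs_nonneg _
  have h2 := (Real.sqrt_lt' ((Real.sqrt_nonneg _).trans_lt h)).mp h
  have h3 : 8 * t * q ≤ |p - q| ^ 2 :=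
    (mul_le_mul_of_nonneg_left (le_max_left _ _) (by positivity)).trans h2.le
  have h4 : (8 * t) ^ 2 ≤ |p - q| ^ 2 := by
    rw [sq (8 * t)]
    exact (mul_le_mul_of_nonneg_left (le_max_right _ _) (by positivity)).trans h2.le
  have h5 : 8 * t ≤ |p - q| := (sq_le_sq₀ (by positivity) hu).mp h4
  refine ⟨h5, ?_⟩
  have h6 : p ≤ q + |p - q| := by linarith [le_abs_self (p - q)]
  nlinarith

/-- Deviation bound for a single set, with a plug-in penalty. -/
lemma measureReal_sqrt_lt_abs_sub_le {d n : ℕ} (hn : 1 ≤ n) (P : Measure (Pt d))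
    [IsProbabilityMeasure P] {A : Set (Pt d)} (hA : MeasurableSet A) {t : ℝ} (ht : 0 < t) :
    (Pn P n).real {ω | √(8 * t * max (Phat ω A) (8 * t)) < |P.real A - Phat ω A|} ≤
      2 * Real.exp (-(n * t)) := by
  have : IsProbabilityMeasure (Pn P n) := by unfold Pn; infer_instance
  obtain ⟨x, hx0, hx1, hx⟩ := exists_chernoff_parameter (p := P.real A) ht
  have hxabs : |x| ≤ 1 := by rwa [abs_of_nonneg hx0]
  have hup := measureReal_chernoff_le hn P hA hxabs t
  have hlow := measureReal_chernoff_le hn P hA (x := -x) (by rwa [abs_neg]) t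
  rw [two_mul]
  refine (measureReal_mono ?_).trans ((measureReal_union_le _ _).trans (add_le_add hup hlow))
  intro ω hω
  obtain ⟨h1, h2⟩ := le_abs_sub_of_sqrt_lt ht hω
  have h3 := hx _ h1 h2
  rcases abs_cases (P.real A - Phat ω A) with h | h <;> rw [h.1] at h3
  · right
    simp only [Set.mem_ofPred_eq, neg_sq]
    linarith
  · left
    simp only [Set.mem_ofPred_eq]
    linarith

/-- Outside the single-cell deviation events, the uniform deviation is at most the penalty. -/
lemma iSup_abs_fbar_sub_fhat_le_pen {d n : ℕ} (P : Measure (Pt d)) (j : ℕ)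
    (δ : ℝ) (ω : Fin n → Pt d)
    (h : ∀ k : CellIdx d j, |P.real (cell d j k) - Phat ω (cell d j k)| ≤
      √(8 * (Real.log ((2 : ℝ) ^ (j * (d + 1)) * 16 / δ) / n) *
        max (Phat ω (cell d j k)) (8 * (Real.log ((2 : ℝ) ^ (j * (d + 1)) * 16 / δ) / n)))) :
    (⨆ k : CellIdx d j, |fbar P j k - fhat j ω k|) ≤ pen d n j δ ω := by
  refine ciSup_mono (Set.finite_range _).bddAbove fun k => ?_
  set L := Real.log ((2 : ℝ) ^ (j * (d + 1)) * 16 / δ)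
  have hM : (0 : ℝ) < 2 ^ (j * d) := by positivity
  have hL : L / ((n : ℝ) / 2 ^ (j * d)) = L / n * 2 ^ (j * d) := by
    rw [div_div_eq_mul_div, div_mul_eq_mul_div]
  rw [hL, fbar, fhat, ← sub_mul, abs_mul, abs_of_pos hM, ← mul_assoc 8 (L / n),
    ← max_mul_of_nonneg _ _ hM.le, mul_mul_mul_comm, Real.sqrt_mul' _ (mul_self_nonneg _),
    Real.sqrt_mul_self hM.le]
  exact mul_le_mul_of_nonneg_right (h k) hM.le

/-- **Lemma A.1**: with probability at least `1 - δ`, simultaneously for all `j ≥ 0`,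
`max_{A ∈ 𝒜_j} |f̄(A) - f̂(A)| ≤ Ψ_j`. -/
theorem statement3 (d n : ℕ) (hd : 1 ≤ d) (hn : 1 ≤ n)
    (f : Pt d → ℝ) (P : Measure (Pt d)) (hf : IsDensity d f P)
    (δ : ℝ) (hδ0 : 0 < δ) (hδ1 : δ < 1) :
    ENNReal.ofReal (1 - δ) ≤ Pn P n {ω | ∀ j : ℕ,
      (⨆ k : CellIdx d j, |fbar P j k - fhat j ω k|) ≤ pen d n j δ ω} := by
  have : IsProbabilityMeasure P := hf.2.2.2.2
  have : IsProbabilityMeasure (Pn P n) := by unfold Pn; infer_instance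
  let t : ℕ → ℝ := fun j => Real.log ((2 : ℝ) ^ (j * (d + 1)) * 16 / δ) / n
  have hn0 : (0 : ℝ) < n := by positivity
  have hone : ∀ j : ℕ, (1 : ℝ) < 2 ^ (j * (d + 1)) * 16 / δ := fun j => by
    rw [one_lt_div hδ0]
    nlinarith [one_le_pow₀ (M₀ := ℝ) (a := 2) (n := j * (d + 1)) one_le_two]
  have ht : ∀ j, 0 < t j := fun j => div_pos (Real.log_pos (hone j)) hn0
  let bad : (j : ℕ) → CellIdx d j → Set (Fin n → Pt d) := fun j k =>
    {ω | √(8 * t j * max (Phat ω (cell d j k)) (8 * t j)) <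
      |P.real (cell d j k) - Phat ω (cell d j k)|}
  have hbad : ∀ j k, Pn P n (bad j k) ≤
      ENNReal.ofReal (2 * (δ / (2 ^ (j * (d + 1)) * 16))) := by
    intro j k
    rw [← ofReal_measureReal]
    refine ENNReal.ofReal_le_ofReal
      ((measureReal_sqrt_lt_abs_sub_le hn P (measurableSet_cell d j k) (ht j)).trans_eq ?_)
    rw [mul_div_cancel₀ _ hn0.ne', Real.exp_neg, Real.exp_log (zero_lt_one.trans (hone j)), inv_div]
  have hsum : HasSum (fun j : ℕ => δ / 8 * (1 / 2 : ℝ) ^ j) (δ / 8 * 2) :=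
    hasSum_geometric_two.mul_left _
  have hunion : Pn P n (⋃ j, ⋃ k, bad j k) ≤ ENNReal.ofReal δ := by
    calc Pn P n (⋃ j, ⋃ k, bad j k)
        ≤ ∑' j, ∑ k, Pn P n (bad j k) :=
          (measure_iUnion_le _).trans (ENNReal.tsum_le_tsum fun j => measure_iUnion_fintype_le _ _)
      _ ≤ ∑' j, ENNReal.ofReal (δ / 8 * (1 / 2 : ℝ) ^ j) := by
          refine ENNReal.tsum_le_tsum fun j => (Finset.sum_le_sum fun k _ => hbad j k).trans_eq ?_
          rw [Finset.sum_const, Finset.card_univ, Fintype.card_fun, Fintype.card_fin,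
            Fintype.card_fin, ← ENNReal.ofReal_nsmul]
          congr 1
          simp only [nsmul_eq_mul, Nat.cast_pow, Nat.cast_ofNat, ← pow_mul, mul_add, pow_add,
            mul_one, one_div, inv_pow]
          field_simp
          norm_num
      _ = ENNReal.ofReal (δ / 8 * 2) := by
          rw [← hsum.tsum_eq, ENNReal.ofReal_tsum_of_nonneg (fun j => by positivity) hsum.summable]
      _ ≤ ENNReal.ofReal δ := ENNReal.ofReal_le_ofReal (by linarith)
  have hcover : (⋃ j, ⋃ k, bad j k)ᶜ ⊆ {ω | ∀ j : ℕ,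
      (⨆ k : CellIdx d j, |fbar P j k - fhat j ω k|) ≤ pen d n j δ ω} := by
    intro ω hω j
    refine iSup_abs_fbar_sub_fhat_le_pen P j δ ω fun k => ?_
    by_contra hk
    exact hω (Set.mem_iUnion₂.mpr ⟨j, k, not_le.mp hk⟩)
  rw [ENNReal.ofReal_sub _ hδ0.le, ENNReal.ofReal_one, tsub_le_iff_left,
    ← measure_univ (μ := Pn P n), ← Set.union_compl_self (⋃ j, ⋃ k, bad j k)]
  exact (measure_union_le _ _).trans (add_le_add hunion (measure_mono hcover))

end
end

section
/- Let X₁,…,Xₙ be i.i.d. from a probability measure P on [0,1]^d with density f bounded by f_max, and let Ψ_j be the penalty with confidence parameter δ = 1/n. There exist constants c₃ > 0 and c₄ ≡ c₄(f_max, d) > 0 such that if j ≡ j(n) satisfies 2^{j(n)} ≤ κ·(n/log n)^{1/d} for some constant κ and all n ≥ 2, then for all n, with probability at least 1 − 1/n, c₃·√(2^{jd}·(log n)/n) ≤ Ψ_j ≤ c₄·√(2^{jd}·(log n)/n). Moreover the lower bound holds deterministically: Ψ_j ≥ √(2^{jd}·8·log(16n)/n) always. -/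
open MeasureTheory Filter

noncomputable section

lemma exists_mem_cell {d : ℕ} (j : ℕ) {x : Pt d} (hx : x ∈ cube d) :
    ∃ k : CellIdx d j, x ∈ cell d j k := by
  have key : ∀ i : Fin d, ∃ m : Fin (2 ^ j), ((m : ℕ) : ℝ) / 2 ^ j ≤ x i ∧
      (x i < (((m : ℕ) : ℝ) + 1) / 2 ^ j ∨ ((m : ℕ) + 1 = 2 ^ j ∧ x i ≤ 1)) := by
    intro i
    obtain ⟨h0, h1⟩ := hx i
    have hp : (0 : ℝ) < 2 ^ j := by positivity
    rcases h1.lt_or_eq with h1' | h1'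
    · have hnn : 0 ≤ x i * 2 ^ j := by positivity
      have hlt : ⌊x i * 2 ^ j⌋₊ < 2 ^ j := by
        rw [Nat.floor_lt hnn]
        push_cast
        nlinarith
      refine ⟨⟨_, hlt⟩, ?_, Or.inl ?_⟩
      · rw [div_le_iff₀ hp]
        exact Nat.floor_le hnn
      · rw [lt_div_iff₀ hp]
        exact Nat.lt_floor_add_one _
    · have hj : 2 ^ j - 1 + 1 = 2 ^ j := Nat.sub_add_cancel Nat.one_le_two_pow
      refine ⟨⟨2 ^ j - 1, by omega⟩, ?_, Or.inr ⟨hj, h1⟩⟩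
      rw [div_le_iff₀ hp, h1', one_mul]
      exact_mod_cast Nat.sub_le _ _
  choose k hk using key
  exact ⟨k, hk⟩

lemma card_cellIdx (d j : ℕ) : Fintype.card (CellIdx d j) = 2 ^ (j * d) := by
  simp [CellIdx, pow_mul]

lemma exists_one_le_fhat {d n : ℕ} (j : ℕ) (hn : 1 ≤ n) {ω : Fin n → Pt d}
    (hω : ∀ i, ω i ∈ cube d) : ∃ k : CellIdx d j, 1 ≤ fhat j ω k := by
  have hn' : (0 : ℝ) < n := by exact_mod_cast hn
  have hp : (0 : ℝ) < 2 ^ (j * d) := by positivity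
  have hsum : (n : ℝ) ≤ ∑ k : CellIdx d j, ∑ i, (cell d j k).indicator (fun _ => (1 : ℝ)) (ω i) := by
    rw [Finset.sum_comm]
    calc (n : ℝ) = ∑ _i : Fin n, (1 : ℝ) := by simp
      _ ≤ _ := Finset.sum_le_sum fun i _ => ?_
    obtain ⟨k, hk⟩ := exists_mem_cell j (hω i)
    calc (1 : ℝ) = (cell d j k).indicator (fun _ => (1 : ℝ)) (ω i) := by simp [hk]
      _ ≤ _ := Finset.single_le_sum
        (f := fun k => (cell d j k).indicator (fun _ => (1 : ℝ)) (ω i))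
        (fun k _ => Set.indicator_nonneg (by simp) _) (Finset.mem_univ k)
  by_contra! h
  have hlt : ∑ k : CellIdx d j, fhat j ω k < ∑ _k : CellIdx d j, (1 : ℝ) :=
    Finset.sum_lt_sum_of_nonempty Finset.univ_nonempty fun k _ => h k
  simp only [fhat, Phat, ← Finset.sum_mul, ← Finset.sum_div, Finset.sum_const, Finset.card_univ,
    card_cellIdx, nsmul_eq_mul, mul_one] at hlt
  push_cast at hlt
  have : (1 : ℝ) ≤ (∑ k : CellIdx d j, ∑ i, (cell d j k).indicator (fun _ => (1 : ℝ)) (ω i)) / n := by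
    rwa [le_div_iff₀ hn', one_mul]
  nlinarith

lemma le_pen {d n : ℕ} (j : ℕ) (δ : ℝ) (ω : Fin n → Pt d) (k : CellIdx d j) :
    Real.sqrt (8 * (Real.log ((2 : ℝ) ^ (j * (d + 1)) * 16 / δ) / ((n : ℝ) / 2 ^ (j * d))) *
      max (fhat j ω k)
        (8 * (Real.log ((2 : ℝ) ^ (j * (d + 1)) * 16 / δ) / ((n : ℝ) / 2 ^ (j * d))))) ≤
      pen d n j δ ω :=
  le_ciSup (f := fun k : CellIdx d j => Real.sqrt (8 * (Real.log ((2 : ℝ) ^ (j * (d + 1)) * 16 / δ) /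
    ((n : ℝ) / 2 ^ (j * d))) * max (fhat j ω k)
      (8 * (Real.log ((2 : ℝ) ^ (j * (d + 1)) * 16 / δ) / ((n : ℝ) / 2 ^ (j * d))))))
    (Set.finite_range _).bddAbove k

lemma sqrt_le_pen {d n : ℕ} (j : ℕ) (hn : 1 ≤ n) {ω : Fin n → Pt d} (hω : ∀ i, ω i ∈ cube d) :
    Real.sqrt (2 ^ (j * d) * (8 * Real.log (16 * n) / n)) ≤ pen d n j (1 / n) ω := by
  obtain ⟨k, hk⟩ := exists_one_le_fhat j hn hω
  refine le_trans (Real.sqrt_le_sqrt ?_) (le_pen j _ ω k)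
  have hn' : (1 : ℝ) ≤ n := by exact_mod_cast hn
  have hlog : Real.log (16 * n) ≤ Real.log ((2 : ℝ) ^ (j * (d + 1)) * 16 / (1 / n)) := by
    apply Real.log_le_log (by positivity)
    rw [div_div_eq_mul_div, div_one, mul_assoc]
    exact le_mul_of_one_le_left (by positivity) (one_le_pow₀ one_le_two)
  have h0 : 0 ≤ Real.log (16 * n) := Real.log_nonneg (by linarith)
  set L := Real.log ((2 : ℝ) ^ (j * (d + 1)) * 16 / (1 / n))
  have hmax := hk.trans (le_max_left _ (8 * (L / ((n : ℝ) / 2 ^ (j * d)))))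
  calc (2 : ℝ) ^ (j * d) * (8 * Real.log (16 * n) / n)
      = 8 * (Real.log (16 * n) / ((n : ℝ) / 2 ^ (j * d))) := by field_simp
    _ ≤ 8 * (L / ((n : ℝ) / 2 ^ (j * d))) := by gcongr
    _ ≤ _ := le_mul_of_one_le_right (by have := h0.trans hlog; positivity) hmax

lemma volume_cell_le (d j : ℕ) (k : CellIdx d j) :
    volume (cell d j k) ≤ ENNReal.ofReal (((2 : ℝ) ^ (j * d))⁻¹) := by
  have hsub : cell d j k ⊆ (WithLp.ofLp : Pt d → Fin d → ℝ) ⁻¹'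
      Set.Icc (fun i => ((k i : ℕ) : ℝ) / 2 ^ j) (fun i => (((k i : ℕ) : ℝ) + 1) / 2 ^ j) := by
    intro x hx
    refine ⟨fun i => (hx i).1, fun i => ?_⟩
    rcases (hx i).2 with h | ⟨h, h'⟩
    · exact h.le
    · have : (((k i : ℕ) : ℝ) + 1) = 2 ^ j := by exact_mod_cast h
      simpa [this] using h'
  refine (measure_mono hsub).trans ?_
  rw [(PiLp.volume_preserving_ofLp (Fin d)).measure_preimage measurableSet_Icc.nullMeasurableSet,
    Real.volume_Icc_pi, ← ENNReal.ofReal_prod_of_nonneg]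
  · apply le_of_eq
    congr 1
    simp [← sub_div, pow_mul]
  · intro i _
    rw [← sub_div]
    simp

lemma measure_cell_le {d : ℕ} {f : Pt d → ℝ} {P : Measure (Pt d)} {fmax : ℝ}
    (hf : IsDensity d f P) (hb : BoundedBy d f fmax) (hfmax : 0 ≤ fmax) (j : ℕ) (k : CellIdx d j) :
    P.real (cell d j k) ≤ fmax * ((2 : ℝ) ^ (j * d))⁻¹ := by
  refine ENNReal.toReal_le_of_le_ofReal (by positivity) ?_
  rw [hf.2.2.2.1, withDensity_apply _ (measurableSet_cell d j k), ENNReal.ofReal_mul hfmax]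
  calc ∫⁻ x in cell d j k, ENNReal.ofReal (f x)
      ≤ ∫⁻ _ in cell d j k, ENNReal.ofReal fmax :=
        lintegral_mono fun x => ENNReal.ofReal_le_ofReal (hb x)
    _ = ENNReal.ofReal fmax * volume (cell d j k) := setLIntegral_const _ _
    _ ≤ _ := by gcongr; exact volume_cell_le d j k

lemma measurableSet_cube (d : ℕ) : MeasurableSet (cube d) := by
  unfold cube
  measurability

lemma measure_compl_cube {d : ℕ} {f : Pt d → ℝ} {P : Measure (Pt d)} (hf : IsDensity d f P) :
    P (cube d)ᶜ = 0 := by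
  rw [hf.2.2.2.1, withDensity_apply _ (measurableSet_cube d).compl]
  refine (setLIntegral_congr_fun (measurableSet_cube d).compl (g := fun _ => 0) ?_).trans (by simp)
  intro x hx
  simp [hf.2.2.1 x hx]

lemma measureReal_le_sum_indicator_le {d : ℕ} (P : Measure (Pt d)) [IsProbabilityMeasure P] (n : ℕ)
    {A : Set (Pt d)} (hA : MeasurableSet A) (t : ℝ) :
    (Pn P n).real {ω | t ≤ ∑ i, A.indicator (fun _ => (1 : ℝ)) (ω i)} ≤
      Real.exp (2 * n * P.real A - t) := by
  unfold Pn
  set μ : Measure (Fin n → Pt d) := Measure.pi fun _ => P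
  set g : Pt d → ℝ := A.indicator fun _ => 1
  have hg : Measurable g := measurable_const.indicator hA
  have hg1 : ∀ x, g x ≤ 1 := fun x => Set.indicator_le_self' (by simp) x
  have hexp : ∀ x, Real.exp (g x) = 1 + (Real.exp 1 - 1) * g x := by
    intro x
    by_cases hx : x ∈ A <;> simp [g, hx]
  have hgint : Integrable g P := (integrable_const (1 : ℝ)).indicator hA
  have hmgf1 : ∫ x, Real.exp (g x) ∂P ≤ Real.exp (2 * P.real A) := by
    simp_rw [hexp]
    rw [integral_add (integrable_const _) (hgint.const_mul _), integral_const_mul,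
      integral_indicator_const _ hA]
    simp only [integral_const, probReal_univ, smul_eq_mul, mul_one]
    have h3 := Real.exp_one_lt_three
    nlinarith [Real.add_one_le_exp (2 * P.real A), measureReal_nonneg (μ := P) (s := A)]
  have hint : Integrable (fun ω : Fin n → Pt d => Real.exp (1 * ∑ i, g (ω i))) μ := by
    refine Integrable.of_bound (C := Real.exp n)
      (Measurable.aestronglyMeasurable (by fun_prop)) (ae_of_all _ fun ω => ?_)
    rw [Real.norm_eq_abs, Real.abs_exp, Real.exp_le_exp, one_mul]
    simpa using Finset.sum_le_sum fun i (_ : i ∈ Finset.univ) => hg1 (ω i)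
  have hmgf : ProbabilityTheory.mgf (fun ω : Fin n → Pt d => ∑ i, g (ω i)) μ 1 ≤
      Real.exp (2 * n * P.real A) := by
    have : ProbabilityTheory.mgf (fun ω : Fin n → Pt d => ∑ i, g (ω i)) μ 1 =
        (∫ x, Real.exp (g x) ∂P) ^ n := by
      simp only [ProbabilityTheory.mgf, one_mul, Real.exp_sum]
      rw [integral_fintype_prod_eq_prod (fun _ : Fin n => fun x => Real.exp (g x))]
      simp
    rw [this]
    calc _ ≤ Real.exp (2 * P.real A) ^ n := by
          gcongr
      _ = _ := by rw [← Real.exp_nat_mul]; ring_nf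
  calc _ ≤ Real.exp (-1 * t) * ProbabilityTheory.mgf (fun ω => ∑ i, g (ω i)) μ 1 :=
        ProbabilityTheory.measure_ge_le_exp_mul_mgf t zero_le_one hint
    _ ≤ Real.exp (-1 * t) * Real.exp (2 * n * P.real A) := by gcongr
    _ = _ := by rw [← Real.exp_add]; ring_nf

/-- The constant `K` for which `log 2^{jd} ≤ (K + 1) log n` as soon as `2^{jd} log n ≤ D n`. -/
def logConst (D : ℝ) : ℝ := |Real.log (D / Real.log 2)| / Real.log 2

lemma logConst_nonneg (D : ℝ) : 0 ≤ logConst D := by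
  have := Real.log_pos one_lt_two
  unfold logConst
  positivity

lemma log_le_logConst {n : ℕ} (hn : 2 ≤ n) {N D : ℝ} (hN : 0 < N) (hD : 0 < D)
    (h : N * Real.log n ≤ D * n) : Real.log N ≤ (logConst D + 1) * Real.log n := by
  have hn' : (2 : ℝ) ≤ n := by exact_mod_cast hn
  have h2 := Real.log_pos one_lt_two
  have hl : Real.log 2 ≤ Real.log n := Real.log_le_log (by norm_num) hn'
  have hle : N ≤ D / Real.log 2 * n := by
    rw [div_mul_eq_mul_div, le_div_iff₀ h2]
    nlinarith
  calc Real.log N ≤ Real.log (D / Real.log 2 * n) := Real.log_le_log hN hle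
    _ = Real.log (D / Real.log 2) + Real.log n := Real.log_mul (by positivity) (by positivity)
    _ ≤ logConst D * Real.log 2 + Real.log n := by
        rw [logConst, div_mul_cancel₀ _ h2.ne']
        gcongr
        exact le_abs_self _
    _ ≤ (logConst D + 1) * Real.log n := by
        rw [add_mul, one_mul]
        gcongr
        exact logConst_nonneg D

lemma log_penalty_le {d n j : ℕ} (hd : 1 ≤ d) (hn : 2 ≤ n) {D : ℝ} (hD : 0 < D)
    (h : (2 : ℝ) ^ (j * d) * Real.log n ≤ D * n) :
    Real.log ((2 : ℝ) ^ (j * (d + 1)) * 16 / (1 / n)) ≤ (2 * logConst D + 7) * Real.log n := by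
  have hn' : (2 : ℝ) ≤ n := by exact_mod_cast hn
  have hl : Real.log 2 ≤ Real.log n := Real.log_le_log (by norm_num) hn'
  have hN := log_le_logConst hn (by positivity) hD h
  have h16 : Real.log 16 = 4 * Real.log 2 := by
    rw [show (16 : ℝ) = 2 ^ 4 by norm_num, Real.log_pow]; norm_num
  have hpow : Real.log ((2 : ℝ) ^ (j * (d + 1))) ≤ 2 * Real.log ((2 : ℝ) ^ (j * d)) := by
    have hle : j * (d + 1) ≤ (j * d) * 2 := by nlinarith
    calc _ ≤ Real.log (((2 : ℝ) ^ (j * d)) ^ 2) := by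
          rw [← pow_mul]
          exact Real.log_le_log (by positivity) (pow_le_pow_right₀ one_le_two hle)
      _ = _ := by rw [Real.log_pow]; norm_num
  rw [div_div_eq_mul_div, div_one, Real.log_mul (by positivity) (by positivity),
    Real.log_mul (by positivity) (by norm_num), h16]
  nlinarith

lemma pen_le {d n j : ℕ} (hd : 1 ≤ d) (hn : 2 ≤ n) {D : ℝ} (hD : 0 < D)
    (h : (2 : ℝ) ^ (j * d) * Real.log n ≤ D * n) {M : ℝ} {ω : Fin n → Pt d}
    (hM : ∀ k : CellIdx d j, fhat j ω k ≤ M) :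
    pen d n j (1 / n) ω ≤
      Real.sqrt (8 * (2 * logConst D + 7) * max M (8 * ((2 * logConst D + 7) * D))) *
        Real.sqrt (2 ^ (j * d) * Real.log n / n) := by
  have hn' : (2 : ℝ) ≤ n := by exact_mod_cast hn
  have hl : 0 < Real.log n := Real.log_pos (by linarith)
  have hL := log_penalty_le hd hn hD h
  have hC := logConst_nonneg D
  set C := 2 * logConst D + 7
  have hC' : 0 < C := by positivity
  set a := Real.log ((2 : ℝ) ^ (j * (d + 1)) * 16 / (1 / n)) / ((n : ℝ) / 2 ^ (j * d))
  have hx : (2 : ℝ) ^ (j * d) * Real.log n / n ≤ D := by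
    rw [div_le_iff₀ (by positivity)]
    exact h
  have ha : a ≤ C * (2 ^ (j * d) * Real.log n / n) := by
    calc a ≤ C * Real.log n / ((n : ℝ) / 2 ^ (j * d)) :=
          div_le_div_of_nonneg_right hL (by positivity)
      _ = _ := by field_simp
  have haD : a ≤ C * D := ha.trans (mul_le_mul_of_nonneg_left hx hC'.le)
  have hmax : 0 ≤ max M (8 * (C * D)) := le_max_of_le_right (by positivity)
  refine ciSup_le fun k => ?_
  rw [← Real.sqrt_mul (by positivity)]
  refine Real.sqrt_le_sqrt ?_
  have ha0 : 0 ≤ a := by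
    refine div_nonneg (Real.log_nonneg ?_) (by positivity)
    rw [div_div_eq_mul_div, div_one]
    have : (1 : ℝ) ≤ 2 ^ (j * (d + 1)) := one_le_pow₀ one_le_two
    nlinarith
  calc 8 * a * max (fhat j ω k) (8 * a)
      ≤ 8 * (C * (2 ^ (j * d) * Real.log n / n)) * max M (8 * (C * D)) := by
        gcongr
        exact hM k
    _ = _ := by ring

/-- A level that all empirical average densities stay below with probability `1 - 1/n`. -/
def fhatBound (fmax D : ℝ) : ℝ := 2 * fmax + D * (2 + logConst D)

lemma measureReal_fhat_le {d n j : ℕ} (hn : 2 ≤ n) {f : Pt d → ℝ} {P : Measure (Pt d)} {fmax D : ℝ}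
    (hf : IsDensity d f P) (hb : BoundedBy d f fmax) (hfmax : 0 ≤ fmax) (hD : 0 < D)
    (h : (2 : ℝ) ^ (j * d) * Real.log n ≤ D * n) :
    (Pn P n).real {ω | ∃ k : CellIdx d j, fhatBound fmax D < fhat j ω k} ≤ 1 / n := by
  have := hf.2.2.2.2
  have hn' : (0 : ℝ) < n := by positivity
  have hN : (0 : ℝ) < 2 ^ (j * d) := by positivity
  have hK := logConst_nonneg D
  have hsub : {ω : Fin n → Pt d | ∃ k : CellIdx d j, fhatBound fmax D < fhat j ω k} ⊆
      ⋃ k : CellIdx d j, {ω | n * fhatBound fmax D / 2 ^ (j * d) ≤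
        ∑ i, (cell d j k).indicator (fun _ => (1 : ℝ)) (ω i)} := by
    rintro ω ⟨k, hk⟩
    refine Set.mem_iUnion.2 ⟨k, ?_⟩
    rw [fhat, Phat, div_mul_eq_mul_div, lt_div_iff₀ hn'] at hk
    rw [Set.mem_ofPred_eq, div_le_iff₀ hN]
    linarith
  have hcell : ∀ k : CellIdx d j, (Pn P n).real {ω | n * fhatBound fmax D / 2 ^ (j * d) ≤
      ∑ i, (cell d j k).indicator (fun _ => (1 : ℝ)) (ω i)} ≤
        Real.exp (-((2 + logConst D) * Real.log n)) := by
    intro k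
    refine (measureReal_le_sum_indicator_le P n (measurableSet_cell d j k) _).trans ?_
    rw [Real.exp_le_exp]
    have hlog : Real.log n ≤ D * n * ((2 : ℝ) ^ (j * d))⁻¹ := by
      rw [← div_eq_mul_inv, le_div_iff₀ hN]
      linarith
    calc 2 * n * P.real (cell d j k) - n * fhatBound fmax D / 2 ^ (j * d)
        ≤ 2 * n * (fmax * ((2 : ℝ) ^ (j * d))⁻¹) - n * fhatBound fmax D / 2 ^ (j * d) := by
          gcongr
          exact measure_cell_le hf hb hfmax j k
      _ = -((2 + logConst D) * (D * n * ((2 : ℝ) ^ (j * d))⁻¹)) := by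
          rw [fhatBound]
          ring
      _ ≤ _ := by gcongr
  have : IsProbabilityMeasure (Pn P n) := by unfold Pn; infer_instance
  calc (Pn P n).real {ω | ∃ k : CellIdx d j, fhatBound fmax D < fhat j ω k}
      ≤ _ := measureReal_mono hsub
    _ ≤ _ := measureReal_iUnion_fintype_le _
    _ ≤ ∑ _k : CellIdx d j, Real.exp (-((2 + logConst D) * Real.log n)) :=
        Finset.sum_le_sum fun k _ => hcell k
    _ = Real.exp (Real.log (2 ^ (j * d)) - (2 + logConst D) * Real.log n) := by
        rw [Finset.sum_const, Finset.card_univ, card_cellIdx, sub_eq_add_neg, Real.exp_add,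
          Real.exp_log hN]
        simp
    _ ≤ Real.exp (-Real.log n) := by
        rw [Real.exp_le_exp]
        linarith [log_le_logConst hn hN hD h]
    _ = 1 / n := by rw [Real.exp_neg, Real.exp_log hn', one_div]

lemma ae_forall_mem_cube {d n : ℕ} {f : Pt d → ℝ} {P : Measure (Pt d)} (hf : IsDensity d f P) :
    ∀ᵐ ω ∂Pn P n, ∀ i, ω i ∈ cube d := by
  have := hf.2.2.2.2
  rw [ae_all_iff]
  intro i
  exact (Measure.quasiMeasurePreserving_eval (fun _ : Fin n => P) i).ae
    (measure_compl_cube hf)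

/-- **Lemma A.2**: scaling of the penalty `Ψ_j` (with `δ = 1/n`): with probability at
least `1 - 1/n`, `c₃ √(2^{jd} log n / n) ≤ Ψ_j ≤ c₄ √(2^{jd} log n / n)`; moreover the
lower bound `Ψ_j ≥ √(2^{jd}·8 log(16n)/n)` holds deterministically (for samples in the
domain `[0,1]^d`). -/
theorem statement6 (d : ℕ) (hd : 1 ≤ d) (fmax : ℝ) (hfmax : 0 < fmax)
    (κ : ℝ) (hκ : 0 < κ) :
    ∃ c₃ c₄ : ℝ, 0 < c₃ ∧ 0 < c₄ ∧
      ∀ j : ℕ → ℕ,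
        (∀ n : ℕ, 2 ≤ n → (2 : ℝ) ^ j n ≤ κ * ((n : ℝ) / Real.log n) ^ ((d : ℝ)⁻¹)) →
        ∀ f : Pt d → ℝ, ∀ P : Measure (Pt d), IsDensity d f P → BoundedBy d f fmax →
          (∀ n : ℕ, 2 ≤ n →
            ENNReal.ofReal (1 - 1 / n) ≤ Pn P n {ω |
              c₃ * Real.sqrt (2 ^ (j n * d) * Real.log n / n) ≤ pen d n (j n) (1 / n) ω ∧
              pen d n (j n) (1 / n) ω ≤ c₄ * Real.sqrt (2 ^ (j n * d) * Real.log n / n)}) ∧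
          (∀ n : ℕ, 1 ≤ n → ∀ ω : Fin n → Pt d, (∀ i, ω i ∈ cube d) →
            Real.sqrt (2 ^ (j n * d) * (8 * Real.log (16 * n) / n)) ≤
              pen d n (j n) (1 / n) ω) := by
  have hD : 0 < κ ^ d := by positivity
  have hK := logConst_nonneg (κ ^ d)
  refine ⟨1, Real.sqrt (8 * (2 * logConst (κ ^ d) + 7) *
    max (fhatBound fmax (κ ^ d)) (8 * ((2 * logConst (κ ^ d) + 7) * κ ^ d))), one_pos, ?_, ?_⟩
  · have := lt_max_of_lt_right (b := fhatBound fmax (κ ^ d))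
      (show 0 < 8 * ((2 * logConst (κ ^ d) + 7) * κ ^ d) by positivity)
    positivity
  intro j hj f P hf hb
  have := hf.2.2.2.2
  refine ⟨fun n hn => ?_, fun n hn ω hω => sqrt_le_pen (j n) hn hω⟩
  have hn' : (2 : ℝ) ≤ n := by exact_mod_cast hn
  have hl : 0 < Real.log n := Real.log_pos (by linarith)
  have hsize : (2 : ℝ) ^ (j n * d) * Real.log n ≤ κ ^ d * n := by
    have hpow := pow_le_pow_left₀ (by positivity) (hj n hn) d
    rwa [← pow_mul, mul_pow, Real.rpow_inv_natCast_pow (by positivity) (by omega), ← mul_div_assoc,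
      le_div_iff₀ hl] at hpow
  have hprob : IsProbabilityMeasure (Pn P n) := by unfold Pn; infer_instance
  set s : Set (Fin n → Pt d) := {ω |
    1 * Real.sqrt (2 ^ (j n * d) * Real.log n / n) ≤ pen d n (j n) (1 / n) ω ∧
    pen d n (j n) (1 / n) ω ≤ Real.sqrt (8 * (2 * logConst (κ ^ d) + 7) *
      max (fhatBound fmax (κ ^ d)) (8 * ((2 * logConst (κ ^ d) + 7) * κ ^ d))) *
        Real.sqrt (2 ^ (j n * d) * Real.log n / n)}
  have hbad : (Pn P n).real sᶜ ≤ 1 / n := by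
    refine le_trans (ENNReal.toReal_mono (measure_ne_top _ _) (measure_mono_ae ?_))
      (measureReal_fhat_le (j := j n) hn hf hb hfmax.le hD hsize)
    filter_upwards [ae_forall_mem_cube hf] with ω hω hωs
    show ∃ k : CellIdx d (j n), fhatBound fmax (κ ^ d) < fhat (j n) ω k
    by_contra! hle
    refine hωs ⟨?_, pen_le hd hn hD hsize hle⟩
    refine le_trans ?_ (sqrt_le_pen (j n) (by omega) hω)
    rw [one_mul, mul_div_assoc]
    have hmono : Real.log n ≤ 8 * Real.log (16 * n) := by
      have : Real.log n ≤ Real.log (16 * n) := Real.log_le_log (by linarith) (by linarith)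
      linarith
    gcongr
  rw [ENNReal.ofReal_le_iff_le_toReal (measure_ne_top _ _)]
  have hunion := measureReal_union_le (μ := Pn P n) s sᶜ
  rw [Set.union_compl_self, probReal_univ] at hunion
  change 1 - 1 / (n : ℝ) ≤ (Pn P n).real s
  linarith

end
end

section
/- Fix d ≥ 1 and constants C₃, ε₀ > 0, and let G ⊆ [0,1]^d be a set satisfying assumption [B] (with boundary ∂G). Let j ≥ 0 be an integer and s a real number with s > 8·max(3ε₀^{-1}, 28, 12C₃)·√d, and set j' = ⌊j + log₂ s⌋. Then for every cell A ∈ 𝒜_j there exists a subcell A' ∈ 𝒜_{j'} with A' ⊆ A such that for all x ∈ A', ρ(x, ∂G) ≥ 2^{-j'}. -/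
open MeasureTheory Filter

noncomputable section

theorem le_jprime (j : ℕ) {s : ℝ} (hs : 1 ≤ s) : j ≤ jprime j s := by
  have h : (j : ℤ) ≤ ⌊(j : ℝ) + Real.logb 2 s⌋ := by
    rw [Int.le_floor]
    have := Real.logb_nonneg one_lt_two hs
    push_cast
    linarith
  unfold jprime
  omega

theorem two_pow_mul_lt_two_mul_two_pow_jprime (j : ℕ) {s : ℝ} (hs : 1 ≤ s) :
    (2 : ℝ) ^ j * s < 2 * 2 ^ jprime j s := by
  have hL : 0 ≤ (j : ℝ) + Real.logb 2 s := by
    have := Real.logb_nonneg one_lt_two hs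
    positivity
  have hcast : ((jprime j s : ℕ) : ℤ) = ⌊(j : ℝ) + Real.logb 2 s⌋ :=
    Int.toNat_of_nonneg (Int.floor_nonneg.2 hL)
  have hlt : (j : ℝ) + Real.logb 2 s < (jprime j s : ℝ) + 1 := by
    have := Int.lt_floor_add_one ((j : ℝ) + Real.logb 2 s)
    rw [← hcast] at this
    exact_mod_cast this
  have h := Real.rpow_lt_rpow_of_exponent_lt one_lt_two hlt
  rw [Real.rpow_add two_pos, Real.rpow_add two_pos, Real.rpow_logb two_pos (by norm_num)
    (by linarith), Real.rpow_natCast, Real.rpow_natCast, Real.rpow_one] at h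
  linarith

/-- A point in the half-open cube underlying a cell lies in some subcell of that cell at any
finer resolution. -/
theorem exists_subcell_mem {d j j' : ℕ} (hj : j ≤ j') (k : CellIdx d j) (x : Pt d)
    (hx : ∀ i, ((k i : ℕ) : ℝ) / 2 ^ j ≤ x i ∧ x i < (((k i : ℕ) : ℝ) + 1) / 2 ^ j) :
    ∃ k' : CellIdx d j', cell d j' k' ⊆ cell d j k ∧ x ∈ cell d j' k' := by
  obtain ⟨m, rfl⟩ := Nat.exists_eq_add_of_le hj
  have hj0 : (0 : ℝ) < 2 ^ j := by positivity
  have hm0 : (0 : ℝ) < 2 ^ m := by positivity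
  have hx0 : ∀ i, 0 ≤ x i := fun i => le_trans (by positivity) (hx i).1
  set q : Fin d → ℕ := fun i => ⌊x i * 2 ^ (j + m)⌋₊
  have hlow : ∀ i, (k i : ℕ) * 2 ^ m ≤ q i := fun i => by
    refine Nat.le_floor ?_
    have h := (div_le_iff₀ hj0).1 (hx i).1
    push_cast
    rw [pow_add, ← mul_assoc]
    gcongr
  have hup : ∀ i, q i < ((k i : ℕ) + 1) * 2 ^ m := fun i => by
    refine (Nat.floor_lt (mul_nonneg (hx0 i) (by positivity))).2 ?_
    have h := (lt_div_iff₀ hj0).1 (hx i).2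
    push_cast
    rw [pow_add, ← mul_assoc]
    gcongr
  have hqlt : ∀ i, q i < 2 ^ (j + m) := fun i => by
    refine (hup i).trans_le ?_
    rw [pow_add]
    exact Nat.mul_le_mul_right _ (k i).2
  refine ⟨fun i => ⟨q i, hqlt i⟩, fun y hy i => ?_, fun i => ⟨?_, Or.inl ?_⟩⟩
  · obtain ⟨h1, h2⟩ := hy i
    have hlow' : ((k i : ℕ) : ℝ) * 2 ^ m ≤ q i := by exact_mod_cast hlow i
    have hup' : (q i : ℝ) + 1 ≤ (((k i : ℕ) : ℝ) + 1) * 2 ^ m := by exact_mod_cast hup i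
    refine ⟨le_trans ?_ h1, ?_⟩
    · rw [div_le_div_iff₀ hj0 (by positivity), pow_add]
      nlinarith
    · rcases h2 with h2 | ⟨h2, h3⟩
      · refine Or.inl (h2.trans_le ?_)
        rw [div_le_div_iff₀ (by positivity) hj0]
        calc ((q i : ℝ) + 1) * 2 ^ j ≤ (((k i : ℕ) : ℝ) + 1) * 2 ^ m * 2 ^ j := by gcongr
          _ = (((k i : ℕ) : ℝ) + 1) * 2 ^ (j + m) := by ring
      · refine Or.inr ⟨le_antisymm (k i).2 ?_, h3⟩
        have h4 : 2 ^ j * 2 ^ m ≤ ((k i : ℕ) + 1) * 2 ^ m := by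
          rw [← pow_add, ← h2]
          exact hup i
        exact Nat.le_of_mul_le_mul_right h4 (by positivity)
  · rw [div_le_iff₀ (by positivity)]
    exact Nat.floor_le (mul_nonneg (hx0 i) (by positivity))
  · rw [lt_div_iff₀ (by positivity)]
    exact Nat.lt_floor_add_one _

theorem dist_le_of_mem_cell {d j : ℕ} {k : CellIdx d j} {x y : Pt d} (hx : x ∈ cell d j k)
    (hy : y ∈ cell d j k) : dist x y ≤ Real.sqrt d * ((2 : ℝ) ^ j)⁻¹ := by
  have hle : ∀ z ∈ cell d j k, ∀ i, z i ≤ ((k i : ℕ) : ℝ) / 2 ^ j + ((2 : ℝ) ^ j)⁻¹ := by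
    intro z hz i
    have he : ((k i : ℕ) : ℝ) / 2 ^ j + ((2 : ℝ) ^ j)⁻¹ = (((k i : ℕ) : ℝ) + 1) / 2 ^ j := by
      ring
    rw [he]
    rcases (hz i).2 with h | ⟨h, h'⟩
    · exact h.le
    · have hk : ((k i : ℕ) : ℝ) + 1 = 2 ^ j := by exact_mod_cast h
      rwa [hk, div_self (by positivity)]
  have hcoord : ∀ i, dist (x i) (y i) ^ 2 ≤ (((2 : ℝ) ^ j)⁻¹) ^ 2 := fun i => by
    refine pow_le_pow_left₀ dist_nonneg ?_ 2
    rw [Real.dist_eq, abs_le]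
    constructor <;> linarith [hle x hx i, hle y hy i, (hx i).1, (hy i).1]
  rw [EuclideanSpace.dist_eq]
  refine Real.sqrt_le_iff.2 ⟨by positivity, ?_⟩
  refine (Finset.sum_le_sum fun i _ => hcoord i).trans ?_
  rw [mul_pow, Real.sq_sqrt (Nat.cast_nonneg d)]
  simp

theorem abs_coord_sub_le_dist {d : ℕ} (x y : Pt d) (i : Fin d) : |x i - y i| ≤ dist x y := by
  rw [dist_eq_norm, ← Real.norm_eq_abs]
  exact PiLp.norm_apply_le (x - y) i

theorem frontier_nonempty_of_subset_cube {d : ℕ} (hd : 1 ≤ d) {G : Set (Pt d)}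
    (hG : G ⊆ cube d) (hne : G.Nonempty) : (frontier G).Nonempty := by
  refine nonempty_frontier_iff.2 ⟨hne, fun h => ?_⟩
  have h2 : (WithLp.toLp 2 (fun _ => 2) : Pt d) ∈ cube d := hG (h ▸ Set.mem_univ _)
  have h3 := (h2 ⟨0, hd⟩).2
  norm_num at h3

theorem innerCover_subset {d : ℕ} {ε : ℝ} {G : Set (Pt d)} : innerCover d ε G ⊆ G :=
  Set.iUnion₂_subset fun _ hx => hx

/-- The points of a full ball contained in both the cube and `G` stay away from `∂G`. -/
theorem le_dist_frontier_of_ball_subset {d : ℕ} {G : Set (Pt d)} {x p : Pt d} {ε : ℝ}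
    (hball : Metric.ball x ε ⊆ G) (hp : p ∈ frontier G) : ε ≤ dist x p := by
  by_contra! h
  exact hp.2 (interior_maximal hball Metric.isOpen_ball (by rwa [Metric.mem_ball']))

/-- Under assumption [B], if `s > 8 max(3ε₀⁻¹, 28, 12C₃)√d` and `j' = ⌊j + log₂ s⌋`, every
cell at resolution `j` contains a subcell at resolution `j'` all of whose points are at
distance at least `2^{-j'}` from `∂G`. -/
theorem statement13 (d : ℕ) (hd : 1 ≤ d) (C₃ ε₀ : ℝ) (hC₃ : 0 < C₃) (hε₀ : 0 < ε₀)
    (G : Set (Pt d)) (hG : G ⊆ cube d) (hB : AB d G C₃ ε₀)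
    (j : ℕ) (s : ℝ) (hs : 8 * max (3 * ε₀⁻¹) (max 28 (12 * C₃)) * Real.sqrt d < s) :
    ∀ k : CellIdx d j, ∃ k' : CellIdx d (jprime j s),
      cell d (jprime j s) k' ⊆ cell d j k ∧
      ∀ x ∈ cell d (jprime j s) k',
        ((2 : ℝ) ^ jprime j s)⁻¹ ≤ Metric.infDist x (frontier G) := by
  intro k
  set M : ℝ := max (3 * ε₀⁻¹) (max 28 (12 * C₃))
  have hM1 : 3 * ε₀⁻¹ ≤ M := le_max_left _ _
  have hM2 : 28 ≤ M := (le_max_left _ _).trans (le_max_right _ _)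
  have hM3 : 12 * C₃ ≤ M := (le_max_right _ _).trans (le_max_right _ _)
  have hd1 : 1 ≤ Real.sqrt d := Real.one_le_sqrt.2 (by exact_mod_cast hd)
  have hs1 : 1 ≤ s := by nlinarith
  have hjj := le_jprime j hs1
  have hpow := two_pow_mul_lt_two_mul_two_pow_jprime j hs1
  generalize jprime j s = j' at hjj hpow ⊢
  set h : ℝ := ((2 : ℝ) ^ j)⁻¹ with hh
  set h' : ℝ := ((2 : ℝ) ^ j')⁻¹ with hh'
  have hpos : 0 < h := by positivity
  have hpos' : 0 < h' := by positivity
  have hle1 : h ≤ 1 := inv_le_one_of_one_le₀ (one_le_pow₀ one_le_two)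
  have hfine : h' * s < 2 * h := by
    have e1 : (2 : ℝ) ^ j * h = 1 := mul_inv_cancel₀ (by positivity)
    have e2 : (2 : ℝ) ^ j' * h' = 1 := mul_inv_cancel₀ (by positivity)
    calc h' * s = (2 ^ j * s) * (h * h') := by linear_combination (-(h' * s)) * e1
      _ < (2 * 2 ^ j') * (h * h') := by gcongr
      _ = 2 * h := by linear_combination (2 * h) * e2
  set ε : ℝ := (Real.sqrt d + 1) * h' with hε
  have hεpos : 0 < ε := by positivity
  have hεM : 2 * (M * ε) < h := by
    have h1 : h' * (8 * M * Real.sqrt d) < 2 * h := by nlinarith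
    have h2 : M * ε ≤ M * (2 * Real.sqrt d * h') := by
      rw [hε]
      gcongr
      linarith
    linarith
  have hε28 : 56 * ε < h := by nlinarith
  have hεC : 24 * (C₃ * ε) < h := by nlinarith
  have hεε₀ : ε ≤ ε₀ := by
    have h1 : 3 * ε₀⁻¹ * ε ≤ M * ε := by gcongr
    have h2 : ε₀⁻¹ * ε < 1 := by linarith
    rw [inv_mul_lt_iff₀ hε₀] at h2
    linarith
  set c : Pt d := WithLp.toLp 2 fun i => ((k i : ℕ) : ℝ) / 2 ^ j + h / 2
  have hci : ∀ i, c i = ((k i : ℕ) : ℝ) / 2 ^ j + h / 2 := fun i => rfl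
  have hedge : ∀ i, (((k i : ℕ) : ℝ) + 1) / 2 ^ j = ((k i : ℕ) : ℝ) / 2 ^ j + h := fun i => by
    rw [hh]
    ring
  have hnear : ∀ y : Pt d, dist y c < h / 4 →
      ∀ i, ((k i : ℕ) : ℝ) / 2 ^ j ≤ y i ∧ y i < (((k i : ℕ) : ℝ) + 1) / 2 ^ j := by
    intro y hy i
    have := abs_le.1 (abs_coord_sub_le_dist y c i)
    rw [hedge i]
    have := hci i
    constructor <;> linarith
  have hnear_cube : ∀ y : Pt d, dist y c < h / 4 → y ∈ cube d := by
    intro y hy i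
    refine ⟨le_trans (by positivity) (hnear y hy i).1, (hnear y hy i).2.le.trans ?_⟩
    rw [div_le_one (by positivity)]
    have hk : ((((k i : ℕ) + 1 : ℕ)) : ℝ) ≤ ((2 ^ j : ℕ) : ℝ) := Nat.cast_le.2 (k i).2
    push_cast at hk
    exact hk
  have hcc : dist c c < h / 4 := by
    rw [dist_self]
    positivity
  obtain ⟨k₀, hk₀, hck₀⟩ := exists_subcell_mem hjj k c (hnear c hcc)
  by_cases hfar : ∀ y ∈ cell d j' k₀, h' ≤ Metric.infDist y (frontier G)
  · exact ⟨k₀, hk₀, hfar⟩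
  push Not at hfar
  obtain ⟨y, hy, hyd⟩ := hfar
  obtain ⟨hne, hcover⟩ := hB ε hεpos hεε₀
  have hfr := frontier_nonempty_of_subset_cube hd hG (hne.mono innerCover_subset)
  obtain ⟨z, hz, hyz⟩ := (Metric.infDist_lt_iff hfr).1 hyd
  have hwd : Metric.infDist z (innerCover d ε G) < h / 24 := by linarith [hcover z hz]
  obtain ⟨w, hw, hzw⟩ := (Metric.infDist_lt_iff hne).1 hwd
  obtain ⟨x, hxG, hwx⟩ := Set.mem_iUnion₂.1 hw
  have hxc : dist x c < h / 8 := by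
    have h1 := dist_le_of_mem_cell hy hck₀
    have h2 : dist x w ≤ ε := dist_comm w x ▸ hwx.2
    have h3 : dist x c ≤ dist x w + dist w z + dist z y + dist y c := by
      linarith [dist_triangle4 x w z y, dist_triangle x y c]
    rw [dist_comm w z, dist_comm z y] at h3
    have h4 : ε = Real.sqrt d * h' + h' := by rw [hε]; ring
    linarith
  have hball : Metric.ball x ε ⊆ G := fun p hp => by
    have hp' : dist p x < ε := hp
    exact hxG ⟨hnear_cube p (by linarith [dist_triangle p x c]), hp'.le⟩
  obtain ⟨k', hk', hxk'⟩ := exists_subcell_mem hjj k x (hnear x (by linarith))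
  refine ⟨k', hk', fun y hy => (Metric.le_infDist hfr).2 fun p hp => ?_⟩
  have h1 := le_dist_frontier_of_ball_subset hball hp
  have h2 := dist_le_of_mem_cell hxk' hy
  have h3 : ε = Real.sqrt d * h' + h' := by rw [hε]; ring
  linarith [dist_triangle x y p]

end
end

section
/- Let d ≥ 1, let G ⊆ [0,1]^d be nonempty, let ε > 0 and C' ≥ 0. Suppose: (i) I_{2ε}(G) ≠ ∅; (ii) S is a nonempty subset of G with sup_{z ∈ I_{2ε}(G)} ρ(z, S) ≤ ε; and (iii) for all y ∈ ∂G, ρ(y, I_{2ε}(G)) ≤ C'·ε. Then sup_{x ∈ G} ρ(x, S) ≤ (C' + 3)·ε. -/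
open MeasureTheory Filter

noncomputable section

/-- A preconnected set meeting both a set and its complement meets the frontier of that set. -/
theorem inter_frontier_nonempty_of_isPreconnected {X : Type*} [TopologicalSpace X] {t s : Set X}
    (ht : IsPreconnected t) (hs : (t ∩ s).Nonempty) (hsc : (t ∩ sᶜ).Nonempty) :
    (t ∩ frontier s).Nonempty := by
  by_contra h
  have key : ∀ z ∈ t, z ∈ interior s ∨ z ∈ (closure s)ᶜ := by
    intro z hz
    by_contra! hzs
    exact h ⟨z, hz, not_not.mp hzs.2, hzs.1⟩
  obtain ⟨x, hxt, hxs⟩ := hs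
  obtain ⟨y, hyt, hys⟩ := hsc
  obtain ⟨z, -, hz, hzc⟩ := ht _ _ isOpen_interior isClosed_closure.isOpen_compl key
    ⟨x, hxt, (key x hxt).resolve_right fun hx => hx (subset_closure hxs)⟩
    ⟨y, hyt, (key y hyt).resolve_left fun hy => hys (interior_subset hy)⟩
  exact hzc (subset_closure (interior_subset hz))

/-- A segment from a point of `G` to a point outside `G` meets the frontier of `G`, at distance
at most the length of the segment. -/
theorem exists_mem_frontier_dist_le {E : Type*} [NormedAddCommGroup E] [NormedSpace ℝ E]
    {G : Set E} {x y : E} (hx : x ∈ G) (hy : y ∉ G) :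
    ∃ w ∈ frontier G, dist x w ≤ dist x y := by
  obtain ⟨w, hw, hwG⟩ := inter_frontier_nonempty_of_isPreconnected
    (convex_segment (𝕜 := ℝ) x y).isPreconnected
    ⟨x, left_mem_segment ℝ x y, hx⟩ ⟨y, right_mem_segment ℝ x y, hy⟩
  refine ⟨w, hwG, ?_⟩
  have := dist_add_dist_of_mem_segment hw
  linarith [dist_nonneg (x := w) (y := y)]

/-- If `S` is within `r` of every point of `T`, then the distance to `S` exceeds the distance
to `T` by at most `r`. -/
theorem infDist_le_infDist_add_of_forall_le {X : Type*} [PseudoMetricSpace X] {S T : Set X}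
    (hT : T.Nonempty) {r : ℝ} (h : ∀ z ∈ T, Metric.infDist z S ≤ r) (x : X) :
    Metric.infDist x S ≤ Metric.infDist x T + r := by
  rw [← sub_le_iff_le_add, Metric.le_infDist hT]
  intro z hz
  linarith [h z hz, Metric.infDist_le_infDist_add_dist (s := S) (x := x) (y := z)]

/-- If `S ⊆ G` is nonempty with `sup_{z ∈ I_{2ε}(G)} ρ(z,S) ≤ ε` and every boundary point
of `G` is within `C'ε` of `I_{2ε}(G)`, then `sup_{x ∈ G} ρ(x,S) ≤ (C'+3)ε`. -/
theorem statement16 (d : ℕ) (hd : 1 ≤ d) (G : Set (Pt d)) (hG : G ⊆ cube d)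
    (hGne : G.Nonempty) (ε C' : ℝ) (hε : 0 < ε) (hC' : 0 ≤ C')
    (hI : (innerCover d (2 * ε) G).Nonempty)
    (S : Set (Pt d)) (hS : S ⊆ G) (hSne : S.Nonempty)
    (h2 : ∀ z ∈ innerCover d (2 * ε) G, Metric.infDist z S ≤ ε)
    (h3 : ∀ y ∈ frontier G, Metric.infDist y (innerCover d (2 * ε) G) ≤ C' * ε) :
    ∀ x ∈ G, Metric.infDist x S ≤ (C' + 3) * ε := by
  intro x hx
  by_cases hb : ballC d x (2 * ε) ⊆ G
  · have hxI : x ∈ innerCover d (2 * ε) G :=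
      Set.mem_biUnion (x := x) hb ⟨hG hx, by rw [dist_self]; positivity⟩
    nlinarith [h2 x hxI, mul_nonneg hC' hε.le]
  · obtain ⟨y, ⟨-, hyd⟩, hyG⟩ := Set.not_subset.mp hb
    obtain ⟨w, hw, hwd⟩ := exists_mem_frontier_dist_le hx hyG
    rw [dist_comm] at hyd
    have h₁ := infDist_le_infDist_add_of_forall_le hI h2 x
    have h₂ := Metric.infDist_le_infDist_add_dist (s := innerCover d (2 * ε) G) (x := x) (y := w)
    linarith [h3 w hw]

end
end

section
/- Let X₁,…,Xₙ be i.i.d. from a probability measure P on [0,1]^d with density f, let 0 < γ, let s_n be a monotone diverging sequence with j' = ⌊j + log₂ s_n⌋, let J ≥ 0, and let ĵ ∈ argmin_{0 ≤ j ≤ J} {V̂_{γ,j} + Ψ_{j'}} (penalty with confidence parameter 0 < δ < 1). Then with probability at least 1 − δ, V_{γ,ĵ} ≤ V̂_{γ,ĵ} + Ψ_{ĵ'} = min_{0 ≤ j ≤ J} {V̂_{γ,j} + Ψ_{j'}} ≤ min_{0 ≤ j ≤ J} {V_{γ,j} + 2Ψ_{j'}}. -/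
open MeasureTheory Filter

noncomputable section

section Concentration

variable {α : Type*} [MeasurableSpace α]

/-- The moment generating function of a Bernoulli indicator is sub-exponential near `0`. -/
lemma integral_exp_mul_indicator_le (P : Measure α) [IsProbabilityMeasure P] {A : Set α}
    (hA : MeasurableSet A) {x : ℝ} (hx : |x| ≤ 1) :
    ∫ a, Real.exp (x * A.indicator (fun _ => (1 : ℝ)) a) ∂P ≤
      Real.exp (P.real A * (x + x ^ 2)) := by
  have hrw : ∀ a, Real.exp (x * A.indicator (fun _ => (1 : ℝ)) a) =
      1 + A.indicator (fun _ => Real.exp x - 1) a := by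
    intro a
    by_cases ha : a ∈ A <;> simp [ha]
  simp_rw [hrw]
  rw [integral_add (integrable_const _) ((integrable_const _).indicator hA),
    integral_indicator_const _ hA]
  simp only [integral_const, probReal_univ, smul_eq_mul, mul_one]
  have h := (abs_le.1 (Real.abs_exp_sub_one_sub_id_le hx)).2
  calc 1 + P.real A * (Real.exp x - 1) ≤ P.real A * (x + x ^ 2) + 1 := by
        have := mul_le_mul_of_nonneg_left (show Real.exp x - 1 ≤ x + x ^ 2 by linarith)
          (measureReal_nonneg (μ := P) (s := A))
        linarith
    _ ≤ _ := Real.add_one_le_exp _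

lemma chernoff_indicator_sum (P : Measure α) [IsProbabilityMeasure P] {A : Set α}
    (hA : MeasurableSet A) {x : ℝ} (hx : |x| ≤ 1) (n : ℕ) (L : ℝ) :
    (Measure.pi fun _ : Fin n => P).real
      {ω | n * (P.real A * (x + x ^ 2)) + L ≤
        x * ∑ i, A.indicator (fun _ => (1 : ℝ)) (ω i)} ≤ Real.exp (-L) := by
  set g : α → ℝ := fun a => Real.exp (x * A.indicator (fun _ => (1 : ℝ)) a) with hg
  set c := n * (P.real A * (x + x ^ 2)) with hc
  have hgm : Measurable g :=
    Real.measurable_exp.comp ((measurable_const.indicator hA).const_mul x)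
  have hgi : Integrable g P := by
    refine Integrable.of_bound hgm.aestronglyMeasurable (Real.exp |x|) (ae_of_all _ fun a => ?_)
    rw [hg, Real.norm_eq_abs, Real.abs_exp, Real.exp_le_exp]
    by_cases ha : a ∈ A <;> simp [ha, le_abs_self]
  have hint : Integrable (fun ω : Fin n → α => ∏ i, g (ω i)) (Measure.pi fun _ => P) :=
    Integrable.fintype_prod fun _ => hgi
  have hmarkov := mul_meas_ge_le_integral_of_nonneg
    (ae_of_all _ fun ω => Finset.prod_nonneg fun i _ => (Real.exp_pos _).le) hint
    (Real.exp (c + L))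
  have hprod : ∫ ω : Fin n → α, ∏ i, g (ω i) ∂(Measure.pi fun _ => P) ≤ Real.exp c := by
    rw [integral_fintype_prod_eq_prod (fun _ => g), Finset.prod_const, Finset.card_univ,
      Fintype.card_fin, hc, Real.exp_nat_mul]
    exact pow_le_pow_left₀ (integral_nonneg fun _ => (Real.exp_pos _).le)
      (integral_exp_mul_indicator_le P hA hx) n
  have hset : {ω : Fin n → α | Real.exp (c + L) ≤ ∏ i, g (ω i)} =
      {ω | c + L ≤ x * ∑ i, A.indicator (fun _ => (1 : ℝ)) (ω i)} := by
    ext ω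
    simp only [hg, Set.mem_ofPred_eq, ← Real.exp_sum, Real.exp_le_exp, Finset.mul_sum]
  rw [hset] at hmarkov
  have h := hmarkov.trans hprod
  rw [Real.exp_add, mul_assoc] at h
  have h2 := le_of_mul_le_mul_left (h.trans_eq (mul_one _).symm) (Real.exp_pos c)
  rw [Real.exp_neg, ← one_div, le_div_iff₀' (Real.exp_pos L)]
  exact h2

end Concentration

/-- Inverting the two-sided Chernoff bound so that the deviation is controlled empirically. -/
lemma abs_sub_le_sqrt_of_forall {p q a x : ℝ} (hp : 0 ≤ p) (ha : 0 < a)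
    (hx : x = if a ≤ p then Real.sqrt (a / p) else 1)
    (hup : x * q ≤ p * (x + x ^ 2) + a) (hlo : -x * q ≤ p * (-x + x ^ 2) + a) :
    |q - p| ≤ Real.sqrt (8 * a * max q (8 * a)) := by
  have hq1 := le_max_left q (8 * a)
  have hq2 := le_max_right q (8 * a)
  set m := max q (8 * a)
  have hm : 0 < m := by linarith
  have key : ∀ t : ℝ, 0 ≤ t → |q - p| ≤ t → t ^ 2 ≤ 8 * a * m →
      |q - p| ≤ Real.sqrt (8 * a * m) := fun t _ h1 h2 => h1.trans (Real.le_sqrt_of_sq_le h2)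
  split_ifs at hx with hap
  · have hp0 : 0 < p := ha.trans_le hap
    have hx0 : 0 < x := hx ▸ Real.sqrt_pos.2 (div_pos ha hp0)
    have hxx : p * x ^ 2 = a := by
      rw [hx, Real.sq_sqrt (div_pos ha hp0).le]
      field_simp
    have hdev : |q - p| ≤ 2 * (p * x) := by
      rw [abs_le]
      constructor <;> refine le_of_mul_le_mul_left ?_ hx0 <;> nlinarith
    have hsq : (2 * (p * x)) ^ 2 = 4 * a * p := by
      rw [← hxx]; ring
    by_cases hpm : p ≤ 2 * m
    · refine key _ (by positivity) hdev ?_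
      rw [hsq]
      nlinarith
    · exfalso
      push Not at hpm
      have h1 : p / 2 < 2 * (p * x) := by
        have := neg_le_of_abs_le hdev
        linarith
      have h2 : (p / 2) ^ 2 < (2 * (p * x)) ^ 2 := pow_lt_pow_left₀ h1 (by positivity) two_ne_zero
      rw [hsq] at h2
      nlinarith
  · push Not at hap
    subst hx
    refine key (2 * a) (by positivity) ?_ (by nlinarith)
    rw [abs_le]
    constructor <;> linarith

lemma measure_Phat_deviation_le {d n : ℕ} (hn : 1 ≤ n) (P : Measure (Pt d))
    [IsProbabilityMeasure P] {A : Set (Pt d)} (hA : MeasurableSet A) {L : ℝ} (hL : 0 < L) :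
    (Pn P n).real {ω | ¬ |Phat ω A - P.real A| ≤
      Real.sqrt (8 * (L / n) * max (Phat ω A) (8 * (L / n)))} ≤ 2 * Real.exp (-L) := by
  have hn0 : (0 : ℝ) < n := by exact_mod_cast hn
  have ha : 0 < L / n := div_pos hL hn0
  set p := P.real A
  set x : ℝ := if L / n ≤ p then Real.sqrt (L / n / p) else 1 with hx
  have hx1 : |x| ≤ 1 := by
    rw [hx]
    split_ifs with h
    · rw [abs_of_nonneg (Real.sqrt_nonneg _), Real.sqrt_le_one]
      exact (div_le_one (ha.trans_le h)).2 h
    · simp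
  have hcover : {ω : Fin n → Pt d | ¬ |Phat ω A - p| ≤
      Real.sqrt (8 * (L / n) * max (Phat ω A) (8 * (L / n)))} ⊆
      {ω | n * (p * (x + x ^ 2)) + L ≤ x * ∑ i, A.indicator (fun _ => (1 : ℝ)) (ω i)} ∪
      {ω | n * (p * (-x + (-x) ^ 2)) + L ≤
        -x * ∑ i, A.indicator (fun _ => (1 : ℝ)) (ω i)} := by
    intro ω hω
    by_contra hcon
    simp only [Set.mem_union, Set.mem_ofPred_eq, not_or, not_le] at hcon
    have hscale : ∀ y z : ℝ, y * ∑ i, A.indicator (fun _ => (1 : ℝ)) (ω i) < n * z + L →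
        y * Phat ω A ≤ z + L / n := by
      intro y z h
      rw [Phat, ← mul_div_assoc, div_le_iff₀ hn0, add_mul, div_mul_cancel₀ _ hn0.ne']
      linarith
    refine hω (abs_sub_le_sqrt_of_forall measureReal_nonneg ha hx (hscale _ _ hcon.1) ?_)
    have := hscale _ _ hcon.2
    rwa [neg_sq] at this
  calc _ ≤ _ := measureReal_mono hcover (by exact measure_ne_top (Measure.pi fun _ => P) _)
    _ ≤ _ := measureReal_union_le _ _
    _ ≤ Real.exp (-L) + Real.exp (-L) := add_le_add
        (chernoff_indicator_sum P hA hx1 n L)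
        (chernoff_indicator_sum P hA (by rwa [abs_neg]) n L)
    _ = _ := by ring

/-- Confidence exponent `log (2^{j(d+1)} · 16 / δ)` used at resolution `j`. -/
def logConf (d j : ℕ) (δ : ℝ) : ℝ := Real.log ((2 : ℝ) ^ (j * (d + 1)) * 16 / δ)

lemma logConf_pos (d j : ℕ) {δ : ℝ} (hδ0 : 0 < δ) (hδ1 : δ < 1) : 0 < logConf d j δ := by
  refine Real.log_pos ((one_lt_div hδ0).2 ?_)
  have : (1 : ℝ) ≤ 2 ^ (j * (d + 1)) := one_le_pow₀ one_le_two
  linarith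

lemma exp_neg_logConf (d j : ℕ) {δ : ℝ} (hδ0 : 0 < δ) :
    Real.exp (-logConf d j δ) = δ / (2 ^ (j * (d + 1)) * 16) := by
  rw [logConf, Real.exp_neg, Real.exp_log (by positivity), inv_div]

/-- Samples for which every cell at resolution `j` satisfies the deviation bound. -/
def goodSamples {d : ℕ} (n : ℕ) (P : Measure (Pt d)) (δ : ℝ) (j : ℕ) : Set (Fin n → Pt d) :=
  {ω | ∀ k : CellIdx d j, |Phat ω (cell d j k) - P.real (cell d j k)| ≤
    Real.sqrt (8 * (logConf d j δ / n) *
      max (Phat ω (cell d j k)) (8 * (logConf d j δ / n)))}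

lemma abs_fhat_sub_fbar_le_pen {d n : ℕ} {P : Measure (Pt d)} {δ : ℝ} {j : ℕ}
    {ω : Fin n → Pt d} (hω : ω ∈ goodSamples n P δ j) (k : CellIdx d j) :
    |fhat j ω k - fbar P j k| ≤ pen d n j δ ω := by
  refine le_trans ?_ (le_ciSup (Set.finite_range _).bddAbove k)
  have hc : (0 : ℝ) < 2 ^ (j * d) := by positivity
  change |Phat ω (cell d j k) * 2 ^ (j * d) - P.real (cell d j k) * 2 ^ (j * d)| ≤
    Real.sqrt (8 * (logConf d j δ / ((n : ℝ) / 2 ^ (j * d))) *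
      max (Phat ω (cell d j k) * 2 ^ (j * d)) (8 * (logConf d j δ / ((n : ℝ) / 2 ^ (j * d)))))
  have hL : logConf d j δ / ((n : ℝ) / 2 ^ (j * d)) = logConf d j δ / n * 2 ^ (j * d) := by
    rw [div_div_eq_mul_div, div_mul_eq_mul_div]
  rw [← sub_mul, abs_mul, abs_of_pos hc, hL, ← mul_assoc, ← max_mul_of_nonneg _ _ hc.le,
    show ∀ u v w : ℝ, u * v * (w * v) = u * w * v ^ 2 by intros; ring,
    Real.sqrt_mul' _ (sq_nonneg _), Real.sqrt_sq hc.le]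
  exact mul_le_mul_of_nonneg_right (hω k) hc.le

lemma measure_compl_goodSamples_le {d n : ℕ} (hn : 1 ≤ n) (P : Measure (Pt d))
    [IsProbabilityMeasure P] {δ : ℝ} (hδ0 : 0 < δ) (hδ1 : δ < 1) (j : ℕ) :
    (Pn P n).real (goodSamples n P δ j)ᶜ ≤ δ / 8 * (1 / 2) ^ j := by
  have hset : (goodSamples n P δ j)ᶜ = ⋃ k : CellIdx d j,
      {ω : Fin n → Pt d | ¬ |Phat ω (cell d j k) - P.real (cell d j k)| ≤
        Real.sqrt (8 * (logConf d j δ / n) *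
          max (Phat ω (cell d j k)) (8 * (logConf d j δ / n)))} := by
    ext ω
    simp [goodSamples]
  rw [hset]
  calc _ ≤ _ := measureReal_iUnion_fintype_le _
    _ ≤ ∑ _k : CellIdx d j, 2 * Real.exp (-logConf d j δ) := Finset.sum_le_sum fun k _ =>
        measure_Phat_deviation_le hn P (measurableSet_cell d j k) (logConf_pos d j hδ0 hδ1)
    _ = δ / 8 * (1 / 2) ^ j := by
        rw [exp_neg_logConf d j hδ0, Finset.sum_const, Finset.card_univ, Fintype.card_fun,
          Fintype.card_fin, Fintype.card_fin, nsmul_eq_mul, mul_add, pow_add, mul_one, ← pow_mul]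
        push_cast
        rw [one_div, inv_pow]
        field_simp
        norm_num

lemma ofReal_le_measure_iInter_goodSamples {d n : ℕ} (hn : 1 ≤ n) (P : Measure (Pt d))
    [IsProbabilityMeasure P] {δ : ℝ} (hδ0 : 0 < δ) (hδ1 : δ < 1) :
    ENNReal.ofReal (1 - δ) ≤ Pn P n (⋂ j, goodSamples n P δ j) := by
  have : IsProbabilityMeasure (Pn P n) := by unfold Pn; infer_instance
  have hcompl : Pn P n (⋂ j, goodSamples n P δ j)ᶜ ≤ ENNReal.ofReal δ := by
    rw [Set.compl_iInter]
    calc _ ≤ _ := measure_iUnion_le _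
      _ ≤ ∑' j, ENNReal.ofReal (δ / 8 * (1 / 2) ^ j) := ENNReal.tsum_le_tsum fun j =>
          (ENNReal.le_ofReal_iff_toReal_le (measure_ne_top _ _) (by positivity)).2
            (measure_compl_goodSamples_le hn P hδ0 hδ1 j)
      _ = ENNReal.ofReal (δ / 8 * 2) := by
          rw [← ENNReal.ofReal_tsum_of_nonneg (fun j => by positivity)
            (summable_geometric_two.mul_left _), tsum_mul_left, tsum_geometric_two]
      _ ≤ _ := ENNReal.ofReal_le_ofReal (by linarith)
  rw [ENNReal.ofReal_sub _ hδ0.le, ENNReal.ofReal_one, tsub_le_iff_right]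
  calc (1 : ENNReal) = Pn P n Set.univ := measure_univ.symm
    _ ≤ Pn P n (⋂ j, goodSamples n P δ j) + Pn P n (⋂ j, goodSamples n P δ j)ᶜ := by
      rw [← Set.union_compl_self (⋂ j, goodSamples n P δ j)]
      exact measure_union_le _ _
    _ ≤ _ := add_le_add_right hcompl _

lemma pen_nonneg (d n j : ℕ) (δ : ℝ) (ω : Fin n → Pt d) : 0 ≤ pen d n j δ ω :=
  Real.iSup_nonneg fun _ => Real.sqrt_nonneg _

lemma vernier_le_add {d j j' : ℕ} {γ ε : ℝ} {g h : CellIdx d j' → ℝ} (hε : 0 ≤ ε)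
    (hgh : ∀ k, |g k - h k| ≤ ε) : vernier d γ j j' g ≤ vernier d γ j j' h + ε := by
  unfold vernier
  rw [← sub_le_iff_le_add]
  refine le_ciInf fun k => sub_le_iff_le_add.2 <|
    (ciInf_le (Set.finite_range _).bddBelow k).trans <|
    Real.iSup_le (fun k' => ?_) (add_nonneg (Real.iSup_nonneg fun _ => abs_nonneg _) hε)
  calc |γ - g k'.1| ≤ |γ - h k'.1| + |h k'.1 - g k'.1| := abs_sub_le _ _ _
    _ ≤ _ := add_le_add
        (le_ciSup (f := fun k' : {k' : CellIdx d j' // cell d j' k' ⊆ cell d j k} =>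
          |γ - h k'.1|) (Set.finite_range _).bddAbove k')
        (by rw [abs_sub_comm]; exact hgh _)

/-- Oracle inequality for the penalized vernier criterion: with probability at least
`1 - δ`, `V_{γ,ĵ} ≤ V̂_{γ,ĵ} + Ψ_{ĵ'} = min_{0≤j≤J} {V̂_{γ,j} + Ψ_{j'}} ≤
min_{0≤j≤J} {V_{γ,j} + 2Ψ_{j'}}`. -/
theorem statement17 (d n : ℕ) (hd : 1 ≤ d) (hn : 1 ≤ n)
    (f : Pt d → ℝ) (P : Measure (Pt d)) (hf : IsDensity d f P)
    (γ : ℝ) (hγ : 0 < γ)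
    (s : ℕ → ℝ) (hmono : Monotone s) (hdiv : Tendsto s atTop atTop) (hpos : ∀ m, 0 < s m)
    (J : ℕ) (δ : ℝ) (hδ0 : 0 < δ) (hδ1 : δ < 1)
    (jhat : (Fin n → Pt d) → ℕ)
    (hjhat : ∀ ω : Fin n → Pt d, jhat ω ≤ J ∧ ∀ j ≤ J,
      Vhat d n ω γ (jhat ω) (jprime (jhat ω) (s n)) +
          pen d n (jprime (jhat ω) (s n)) δ ω ≤
        Vhat d n ω γ j (jprime j (s n)) + pen d n (jprime j (s n)) δ ω) :
    ENNReal.ofReal (1 - δ) ≤ Pn P n {ω |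
      V d P γ (jhat ω) (jprime (jhat ω) (s n)) ≤
        Vhat d n ω γ (jhat ω) (jprime (jhat ω) (s n)) +
          pen d n (jprime (jhat ω) (s n)) δ ω ∧
      Vhat d n ω γ (jhat ω) (jprime (jhat ω) (s n)) +
          pen d n (jprime (jhat ω) (s n)) δ ω =
        (⨅ j : Fin (J + 1),
          (Vhat d n ω γ (j : ℕ) (jprime (j : ℕ) (s n)) +
            pen d n (jprime (j : ℕ) (s n)) δ ω)) ∧
      (⨅ j : Fin (J + 1),
          (Vhat d n ω γ (j : ℕ) (jprime (j : ℕ) (s n)) +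
            pen d n (jprime (j : ℕ) (s n)) δ ω)) ≤
        ⨅ j : Fin (J + 1),
          (V d P γ (j : ℕ) (jprime (j : ℕ) (s n)) +
            2 * pen d n (jprime (j : ℕ) (s n)) δ ω)} := by
  have : IsProbabilityMeasure P := hf.2.2.2.2
  refine (ofReal_le_measure_iInter_goodSamples hn P hδ0 hδ1).trans (measure_mono fun ω hω => ?_)
  rw [Set.mem_iInter] at hω
  refine ⟨vernier_le_add (pen_nonneg _ _ _ _ _) fun k => ?_, ?_, ?_⟩
  · rw [abs_sub_comm]
    exact abs_fhat_sub_fbar_le_pen (hω _) k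
  · refine le_antisymm (le_ciInf fun j => (hjhat ω).2 _ (Nat.lt_succ_iff.1 j.2)) ?_
    exact ciInf_le (Set.finite_range fun j : Fin (J + 1) =>
      Vhat d n ω γ (j : ℕ) (jprime (j : ℕ) (s n)) + pen d n (jprime (j : ℕ) (s n)) δ ω).bddBelow
      ⟨jhat ω, Nat.lt_succ_iff.2 (hjhat ω).1⟩
  · refine ciInf_mono (Set.finite_range _).bddBelow fun j => ?_
    rw [two_mul, ← add_assoc]
    gcongr
    exact vernier_le_add (pen_nonneg _ _ _ _ _) (abs_fhat_sub_fbar_le_pen (hω _))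

end
end
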